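/- arXiv:0801.2565 — 3 statements merged into one kernel-verified Lean document; each statement's English description precedes it below -/
import Mathlib

section
/- Let λ and μ be partitions and let z₁, z₂ be invertible elements of a commutative ring R. Then Σ_{(i,j)∈μ} z₁^{1−j} z₂^{1−i} + z₁ z₂ · Σ_{(i,j)∈λ} z₁^{j−1} z₂^{i−1} − (1−z₁)(1−z₂) · (Σ_{(i,j)∈λ} z₁^{j−1} z₂^{i−1}) · (Σ_{(i,j)∈μ} z₁^{1−j} z₂^{1−i}) = Σ_{(i,j)∈μ} z₁^{j−μ_i} z₂^{λ'_j−i+1} + Σ_{(i,j)∈λ} z₁^{λ_i−j+1} z₂^{i−μ'_j}, where all sums range over the boxes of the Young diagrams of μ and λ respectively, and integer powers are taken via the inverses of z₁, z₂. (This is the fixed-point character of the virtual bundle 𝖤 at the pair of monomial ideals (I_λ, I_μ): the right-hand side equals Σ_{□∈μ} z₁^{−a_μ(□)} z₂^{l_λ(□)+1} + Σ_{□∈λ} z₁^{a_λ(□)+1} z₂^{−l_μ(□)}.) -/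
/-!
Carlsson–Okounkov, "Exts and Vertex Operators", Lemma 2 (fixed-point character of the
virtual bundle 𝖤 at the pair of monomial ideals `(I_λ, I_μ)`).
-/

open scoped BigOperators

/-- A partition, given by its (1-indexed) parts `p 1 ≥ p 2 ≥ ⋯ ≥ 0`, with finitely many
nonzero parts.  The value `p 0` is irrelevant. -/
def IsPartition (p : ℕ → ℕ) : Prop :=
  (∀ i j, 1 ≤ i → i ≤ j → p j ≤ p i) ∧ ∃ N, ∀ i, N ≤ i → p i = 0

/-- The Young diagram of `p`: the set of boxes `(i, j)` with `i ≥ 1` and `1 ≤ j ≤ p i`. -/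
def diagram (p : ℕ → ℕ) : Set (ℕ × ℕ) :=
  {x | 1 ≤ x.1 ∧ 1 ≤ x.2 ∧ x.2 ≤ p x.1}

/-- The conjugate partition: `conj p j = #{i ≥ 1 : p i ≥ j}`. -/
noncomputable def conj (p : ℕ → ℕ) (j : ℕ) : ℕ :=
  {i | 1 ≤ i ∧ j ≤ p i}.ncard

open Finset in
/-- A sum over the Young diagram as an iterated sum over rows, with indices shifted to start
at `0`. -/
theorem finsum_mem_diagram {R : Type*} [AddCommMonoid R] (p : ℕ → ℕ) (N : ℕ)
    (hN : ∀ i, N ≤ i → p i = 0) (f : ℕ × ℕ → R) :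
    ∑ᶠ x ∈ diagram p, f x = ∑ i ∈ range N, ∑ j ∈ range (p (i + 1)), f (i + 1, j + 1) := by
  rw [Finset.sum_sigma', ← finsum_mem_coe_finset]
  symm
  refine finsum_mem_eq_of_bijOn (fun x => (x.1 + 1, x.2 + 1)) ⟨?_, ?_, ?_⟩ fun x _ => rfl
  · rintro ⟨i, j⟩ h
    simp only [coe_sigma, Set.mem_sigma_iff, mem_coe, mem_range] at h
    simp only [diagram, Set.mem_ofPred_eq]
    omega
  · rintro ⟨i, j⟩ - ⟨k, l⟩ - h
    simp only [Prod.mk.injEq, Nat.add_right_cancel_iff] at h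
    obtain ⟨rfl, rfl⟩ := h
    rfl
  · rintro ⟨i, j⟩ ⟨hi, hj, hij⟩
    dsimp only at hi hj hij
    have hiN : i < N := by
      by_contra! h
      have := hN i h
      omega
    refine ⟨⟨i - 1, j - 1⟩, ?_, ?_⟩
    · simp only [coe_sigma, Set.mem_sigma_iff, mem_coe, mem_range, Nat.sub_add_cancel hi]
      omega
    · simp only [Nat.sub_add_cancel hi, Nat.sub_add_cancel hj]

open Finset in
/-- The rows of length at least `j + 1` are exactly the first `conj p (j + 1)` rows. -/
theorem lt_conj_iff {p : ℕ → ℕ} (hp : IsPartition p) (j k : ℕ) :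
    k < conj p (j + 1) ↔ j < p (k + 1) := by
  obtain ⟨hanti, N, hN⟩ := hp
  have hfin : {i | 1 ≤ i ∧ j + 1 ≤ p i}.Finite := by
    refine (Set.finite_Iio N).subset fun i hi => ?_
    by_contra h
    have := hN i (by simpa using h)
    have := hi.2
    omega
  constructor
  · intro h
    by_contra! hk
    have hsub : {i | 1 ≤ i ∧ j + 1 ≤ p i} ⊆ (Icc 1 k : Finset ℕ) := by
      intro i hi
      simp only [coe_Icc, Set.mem_Icc]
      refine ⟨hi.1, ?_⟩
      by_contra! hki
      have := hanti (k + 1) i (by omega) hki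
      have := hi.2
      omega
    have := Set.ncard_le_ncard hsub (finite_toSet _)
    rw [Set.ncard_coe_finset, Nat.card_Icc] at this
    unfold conj at h
    omega
  · intro h
    have hsub : ((Icc 1 (k + 1) : Finset ℕ) : Set ℕ) ⊆ {i | 1 ≤ i ∧ j + 1 ≤ p i} := by
      intro i hi
      simp only [coe_Icc, Set.mem_Icc] at hi
      have := hanti i (k + 1) hi.1 hi.2
      exact ⟨hi.1, by omega⟩
    have := Set.ncard_le_ncard hsub hfin
    rw [Set.ncard_coe_finset, Nat.card_Icc] at this
    unfold conj
    omega

open Finset in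
/-- Summation by parts turning column lengths into row lengths. -/
theorem sum_mul_conj {R : Type*} [CommRing R] {p : ℕ → ℕ} (hp : IsPartition p) (N : ℕ)
    (hN : ∀ i, N ≤ i → p i = 0) (m : ℕ) (f g : ℕ → R) :
    ∑ j ∈ range m, g j * f (conj p (j + 1)) =
      (∑ j ∈ range m, g j) * f 0 +
        ∑ k ∈ range N, (f (k + 1) - f k) * ∑ j ∈ range (min m (p (k + 1))), g j := by
  have htel (j : ℕ) : f (conj p (j + 1)) =
      f 0 + ∑ k ∈ range N, if j < p (k + 1) then f (k + 1) - f k else 0 := by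
    have hfilter : {k ∈ range N | j < p (k + 1)} = range (conj p (j + 1)) := by
      ext k
      rw [mem_filter, mem_range, mem_range, lt_conj_iff hp]
      refine and_iff_right_of_imp fun h => ?_
      by_contra! hk
      have := hN (k + 1) (by omega)
      omega
    rw [← sum_filter, hfilter, sum_range_sub]
    ring
  have hmin (l : ℕ) : ∑ j ∈ range (min m l), g j =
      ∑ j ∈ range m, if j < l then g j else 0 := by
    rw [← sum_filter]
    congr 1
    ext j
    simp
  simp_rw [htel, hmin, mul_add, sum_add_distrib, sum_mul, mul_sum]
  rw [sum_comm (s := range N)]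
  congr 1
  refine sum_congr rfl fun j _ => sum_congr rfl fun k _ => ?_
  split_ifs <;> ring

theorem val_zpow_add {R : Type*} [CommRing R] (z : Rˣ) (a b : ℤ) :
    ((z ^ (a + b) : Rˣ) : R) = ((z ^ a : Rˣ) : R) * ((z ^ b : Rˣ) : R) := by
  rw [zpow_add, Units.val_mul]

theorem val_zpow_add_one {R : Type*} [CommRing R] (z : Rˣ) (a : ℤ) :
    ((z ^ (a + 1) : Rˣ) : R) = z * ((z ^ a : Rˣ) : R) := by
  rw [zpow_add_one, Units.val_mul, mul_comm]

open Finset in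
theorem one_sub_mul_sum_zpow {R : Type*} [CommRing R] (z : Rˣ) (n : ℕ) :
    (1 - (z : R)) * ∑ a ∈ range n, ((z ^ (a : ℤ) : Rˣ) : R) = 1 - ((z ^ (n : ℤ) : Rˣ) : R) := by
  simpa using mul_neg_geom_sum (z : R) n

open Finset in
theorem sum_zpow_add_one_sub {R : Type*} [CommRing R] (z : Rˣ) (m : ℕ) :
    ∑ j ∈ range m, ((z ^ ((j : ℤ) + 1 - m) : Rˣ) : R) =
      ∑ j ∈ range m, ((z ^ (-(j : ℤ)) : Rˣ) : R) := by
  rw [← sum_range_reflect]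
  refine sum_congr rfl fun j hj => ?_
  rw [mem_range] at hj
  congr 2
  omega

open Finset in
theorem sum_zpow_sub {R : Type*} [CommRing R] (z : Rˣ) (m : ℕ) :
    ∑ j ∈ range m, ((z ^ ((m : ℤ) - j) : Rˣ) : R) =
      z * ∑ j ∈ range m, ((z ^ (j : ℤ) : Rˣ) : R) := by
  rw [← sum_range_reflect, mul_sum]
  refine sum_congr rfl fun j hj => ?_
  rw [mem_range] at hj
  rw [← val_zpow_add_one]
  congr 2
  omega

open Finset in
theorem one_sub_mul_sum_zpow_neg {R : Type*} [CommRing R] (z : Rˣ) (n : ℕ) :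
    (1 - (z : R)) * ∑ b ∈ range n, ((z ^ (-(b : ℤ)) : Rˣ) : R) =
      ((z ^ (1 - (n : ℤ)) : Rˣ) : R) - z := by
  rw [← sum_zpow_add_one_sub]
  have h : ∀ j ∈ range n, ((z ^ ((j : ℤ) + 1 - n) : Rˣ) : R) =
      ((z ^ (j : ℤ) : Rˣ) : R) * ((z ^ (1 - (n : ℤ)) : Rˣ) : R) := fun j _ => by
    rw [← val_zpow_add]
    congr 2
    omega
  rw [sum_congr rfl h, ← sum_mul, ← mul_assoc, one_sub_mul_sum_zpow, sub_mul, one_mul,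
    ← val_zpow_add]
  simp

open Finset in
/-- The contribution of a pair of rows of lengths `l` and `m`. -/
theorem sum_min_sub_sum_min {R : Type*} [CommRing R] (z : Rˣ) (l m : ℕ) :
    ∑ j ∈ range (min m l), ((z ^ ((j : ℤ) + 1 - m) : Rˣ) : R) -
        ∑ j ∈ range (min l m), ((z ^ ((l : ℤ) - j) : Rˣ) : R) =
      (1 - (z : R)) * (∑ a ∈ range l, ((z ^ (a : ℤ) : Rˣ) : R)) *
        ∑ b ∈ range m, ((z ^ (-(b : ℤ)) : Rˣ) : R) := by
  rcases le_total m l with h | h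
  · rw [min_eq_left h, min_eq_right h, sum_zpow_add_one_sub, one_sub_mul_sum_zpow, sub_mul,
      one_mul, mul_sum]
    simp_rw [sub_eq_add_neg (l : ℤ), val_zpow_add]
  · rw [min_eq_right h, min_eq_left h, sum_zpow_sub, mul_right_comm, one_sub_mul_sum_zpow_neg,
      sub_mul, mul_sum _ _ ((z ^ (1 - (m : ℤ)) : Rˣ) : R)]
    congr 1
    refine sum_congr rfl fun j _ => ?_
    rw [← val_zpow_add]
    congr 2
    ring

open Finset in
theorem sum_row_mul_conj {R : Type*} [CommRing R] {p : ℕ → ℕ} (hp : IsPartition p) (N : ℕ)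
    (hN : ∀ i, N ≤ i → p i = 0) (x y : Rˣ) (m i : ℕ) :
    ∑ j ∈ range m, ((x ^ ((j : ℤ) + 1 - m) : Rˣ) : R) *
        ((y ^ ((conj p (j + 1) : ℤ) - i) : Rˣ) : R) =
      (∑ j ∈ range m, ((x ^ (-(j : ℤ)) : Rˣ) : R)) * ((y ^ (-(i : ℤ)) : Rˣ) : R) -
        (1 - (y : R)) * ∑ k ∈ range N, ((y ^ (k : ℤ) : Rˣ) : R) * ((y ^ (-(i : ℤ)) : Rˣ) : R) *
          ∑ j ∈ range (min m (p (k + 1))), ((x ^ ((j : ℤ) + 1 - m) : Rˣ) : R) := by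
  rw [sum_mul_conj hp N hN m (fun k => ((y ^ ((k : ℤ) - i) : Rˣ) : R)), sum_zpow_add_one_sub,
    mul_sum, sub_eq_add_neg (_ * _), ← sum_neg_distrib]
  congr 1
  · simp
  · refine sum_congr rfl fun k _ => ?_
    simp only [Nat.cast_add, Nat.cast_one, sub_eq_add_neg (_ : ℤ), val_zpow_add, zpow_one]
    ring

open Finset in
theorem sum_row_mul_conj_neg {R : Type*} [CommRing R] {p : ℕ → ℕ} (hp : IsPartition p) (N : ℕ)
    (hN : ∀ i, N ≤ i → p i = 0) (x y : Rˣ) (l k : ℕ) :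
    ∑ j ∈ range l, ((x ^ ((l : ℤ) - j) : Rˣ) : R) *
        ((y ^ ((k : ℤ) + 1 - conj p (j + 1)) : Rˣ) : R) =
      x * y * ((∑ j ∈ range l, ((x ^ (j : ℤ) : Rˣ) : R)) * ((y ^ (k : ℤ) : Rˣ) : R)) +
        (1 - (y : R)) * ∑ i ∈ range N, ((y ^ (k : ℤ) : Rˣ) : R) * ((y ^ (-(i : ℤ)) : Rˣ) : R) *
          ∑ j ∈ range (min l (p (i + 1))), ((x ^ ((l : ℤ) - j) : Rˣ) : R) := by
  rw [sum_mul_conj hp N hN l (fun i => ((y ^ ((k : ℤ) + 1 - i) : Rˣ) : R)), sum_zpow_sub,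
    mul_sum (range N)]
  congr 1
  · rw [Nat.cast_zero, sub_zero, val_zpow_add_one]
    ring
  · refine sum_congr rfl fun i _ => ?_
    have h₁ : (k : ℤ) + 1 - ((i + 1 : ℕ) : ℤ) = k + -i := by omega
    have h₂ : (k : ℤ) + 1 - i = k + -i + 1 := by omega
    rw [h₁, h₂, val_zpow_add_one, val_zpow_add]
    ring

/-- The character of the fiber of the virtual bundle `𝖤` at the torus-fixed point
`(I_λ, I_μ)` equals the hook-type sum
`Σ_{□∈μ} z₁^{-a_μ(□)} z₂^{l_λ(□)+1} + Σ_{□∈λ} z₁^{a_λ(□)+1} z₂^{-l_μ(□)}`. -/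
theorem character_of_E {R : Type*} [CommRing R] (lam mu : ℕ → ℕ)
    (hlam : IsPartition lam) (hmu : IsPartition mu) (z₁ z₂ : Rˣ) :
    (∑ᶠ x ∈ diagram mu,
        ((z₁ ^ (1 - (x.2 : ℤ)) : Rˣ) : R) * ((z₂ ^ (1 - (x.1 : ℤ)) : Rˣ) : R))
      + (z₁ : R) * (z₂ : R) *
        (∑ᶠ x ∈ diagram lam,
          ((z₁ ^ ((x.2 : ℤ) - 1) : Rˣ) : R) * ((z₂ ^ ((x.1 : ℤ) - 1) : Rˣ) : R))
      - (1 - (z₁ : R)) * (1 - (z₂ : R)) *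
        (∑ᶠ x ∈ diagram lam,
          ((z₁ ^ ((x.2 : ℤ) - 1) : Rˣ) : R) * ((z₂ ^ ((x.1 : ℤ) - 1) : Rˣ) : R)) *
        (∑ᶠ x ∈ diagram mu,
          ((z₁ ^ (1 - (x.2 : ℤ)) : Rˣ) : R) * ((z₂ ^ (1 - (x.1 : ℤ)) : Rˣ) : R))
      = (∑ᶠ x ∈ diagram mu,
          ((z₁ ^ ((x.2 : ℤ) - (mu x.1 : ℤ)) : Rˣ) : R) *
            ((z₂ ^ ((conj lam x.2 : ℤ) - (x.1 : ℤ) + 1) : Rˣ) : R))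
        + ∑ᶠ x ∈ diagram lam,
          ((z₁ ^ ((lam x.1 : ℤ) - (x.2 : ℤ) + 1) : Rˣ) : R) *
            ((z₂ ^ ((x.1 : ℤ) - (conj mu x.2 : ℤ)) : Rˣ) : R) := by
  obtain ⟨N₁, hN₁⟩ := hlam.2
  obtain ⟨N₂, hN₂⟩ := hmu.2
  simp only [finsum_mem_diagram lam N₁ hN₁, finsum_mem_diagram mu N₂ hN₂]
  have e₁ (n : ℕ) : 1 - ((n + 1 : ℕ) : ℤ) = -n := by omega
  have e₂ (n : ℕ) : ((n + 1 : ℕ) : ℤ) - 1 = n := by omega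
  have e₃ (a : ℤ) (n : ℕ) : a - ((n + 1 : ℕ) : ℤ) + 1 = a - n := by omega
  simp only [e₁, e₂, e₃]
  simp only [Nat.cast_add, Nat.cast_one, sum_row_mul_conj hlam N₁ hN₁,
    sum_row_mul_conj_neg hmu N₂ hN₂, Finset.sum_add_distrib, Finset.sum_sub_distrib,
    ← Finset.sum_mul, ← Finset.mul_sum]
  have hpairs := Finset.sum_congr (rfl : Finset.range N₁ = _) fun k _ =>
    Finset.sum_congr (rfl : Finset.range N₂ = _) fun i _ =>
      congrArg (((z₂ ^ (k : ℤ) : Rˣ) : R) * ((z₂ ^ (-(i : ℤ)) : Rˣ) : R) * ·)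
        (sum_min_sub_sum_min z₁ (lam (k + 1)) (mu (i + 1)))
  simp only [mul_sub, Finset.sum_sub_distrib] at hpairs
  rw [Finset.sum_comm] at hpairs
  have hprod : (1 - (z₁ : R)) *
      (∑ k ∈ Finset.range N₁, (∑ a ∈ Finset.range (lam (k + 1)), ((z₁ ^ (a : ℤ) : Rˣ) : R)) *
        ((z₂ ^ (k : ℤ) : Rˣ) : R)) *
      (∑ i ∈ Finset.range N₂, (∑ b ∈ Finset.range (mu (i + 1)), ((z₁ ^ (-(b : ℤ)) : Rˣ) : R)) *
        ((z₂ ^ (-(i : ℤ)) : Rˣ) : R)) =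
      ∑ k ∈ Finset.range N₁, ∑ i ∈ Finset.range N₂,
        ((z₂ ^ (k : ℤ) : Rˣ) : R) * ((z₂ ^ (-(i : ℤ)) : Rˣ) : R) *
          ((1 - (z₁ : R)) * (∑ a ∈ Finset.range (lam (k + 1)), ((z₁ ^ (a : ℤ) : Rˣ) : R)) *
            ∑ b ∈ Finset.range (mu (i + 1)), ((z₁ ^ (-(b : ℤ)) : Rˣ) : R)) := by
    rw [mul_assoc, Finset.sum_mul_sum, Finset.mul_sum]
    refine Finset.sum_congr rfl fun k _ => ?_
    rw [Finset.mul_sum]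
    refine Finset.sum_congr rfl fun i _ => ?_
    ring
  rw [← hprod] at hpairs
  linear_combination (1 - (z₂ : R)) * hpairs
end

section
/- Let λ and μ be partitions and let z₁, z₂ be invertible elements of a commutative ring R. Then the hook-type sum is unchanged when the two ranges of summation are interchanged: Σ_{(i,j)∈μ} z₁^{j−μ_i} z₂^{λ'_j−i+1} + Σ_{(i,j)∈λ} z₁^{λ_i−j+1} z₂^{i−μ'_j} = Σ_{(i,j)∈λ} z₁^{j−μ_i} z₂^{λ'_j−i+1} + Σ_{(i,j)∈μ} z₁^{λ_i−j+1} z₂^{i−μ'_j}. (In arm/leg notation: Σ_{□∈μ} z₁^{−a_μ(□)} z₂^{l_λ(□)+1} + Σ_{□∈λ} z₁^{a_λ(□)+1} z₂^{−l_μ(□)} = Σ_{□∈λ} z₁^{−a_μ(□)} z₂^{l_λ(□)+1} + Σ_{□∈μ} z₁^{a_λ(□)+1} z₂^{−l_μ(□)}.) -/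
/-! Carlsson–Okounkov, "Exts and Vertex Operators": interchange of summation ranges in the hook-type character sum (remark after Lemma, proof of Lemma `Lhooks`). -/

open scoped BigOperators

/-- Galois-type characterization of the conjugate partition. -/
theorem IsPartition.le_conj_iff {p : ℕ → ℕ} (hp : IsPartition p) {i j : ℕ}
    (hi : 1 ≤ i) (hj : 1 ≤ j) : i ≤ conj p j ↔ j ≤ p i := by
  obtain ⟨hanti, N, hN⟩ := hp
  have hfin : {k | 1 ≤ k ∧ j ≤ p k}.Finite := by
    refine (Finset.range N).finite_toSet.subset fun k hk => ?_
    by_contra h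
    have := hN k (by simpa using h)
    have := hk.2
    omega
  constructor
  · intro h
    by_contra hlt
    have hsub : {k | 1 ≤ k ∧ j ≤ p k} ⊆ (Finset.Icc 1 (i - 1) : Set ℕ) := by
      intro k hk
      have hki : k < i := by
        by_contra hik
        exact hlt (hk.2.trans (hanti i k hi (by omega)))
      have := hk.1
      simp only [Set.mem_Icc, Finset.coe_Icc]
      omega
    have := Set.ncard_le_ncard hsub (Finset.finite_toSet _)
    rw [Set.ncard_coe_finset, Nat.card_Icc] at this
    unfold conj at h
    omega
  · intro h
    have hsub : (Finset.Icc 1 i : Set ℕ) ⊆ {k | 1 ≤ k ∧ j ≤ p k} := by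
      intro k hk
      simp only [Set.mem_Icc, Finset.coe_Icc] at hk
      exact ⟨hk.1, h.trans (hanti k i hk.1 hk.2)⟩
    have := Set.ncard_le_ncard hsub hfin
    rw [Set.ncard_coe_finset, Nat.card_Icc] at this
    unfold conj
    omega

theorem IsPartition.exists_bound {p : ℕ → ℕ} (hp : IsPartition p) :
    ∃ N, ∀ i j, 1 ≤ i → 1 ≤ j → j ≤ p i → i ≤ N ∧ j ≤ N := by
  obtain ⟨hanti, N, hN⟩ := hp
  refine ⟨max N (p 1), fun i j hi hj hij => ⟨?_, ?_⟩⟩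
  · by_contra h
    have := hN i (by omega)
    omega
  · have := hanti 1 i le_rfl hi
    omega

theorem IsPartition.finite_diagram {p : ℕ → ℕ} (hp : IsPartition p) : (diagram p).Finite := by
  obtain ⟨N, hN⟩ := hp.exists_bound
  refine (Finset.Icc 1 N ×ˢ Finset.Icc 1 N).finite_toSet.subset fun x hx => ?_
  obtain ⟨h1, h2, h3⟩ := hx
  have := hN _ _ h1 h2 h3
  simp only [Finset.coe_product, Finset.coe_Icc, Set.mem_prod, Set.mem_Icc]
  omega

/-- Summation by parts in two directions: the mixed products of horizontal and vertical
differences have the same total. -/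
theorem sum_mixed_differences (M L : ℕ → ℕ → ℤ) (N : ℕ) (hM₁ : ∀ c, M 0 c = 1)
    (hM₂ : ∀ i, M i 0 = 1) (hL : ∀ i c, N < i ∨ N < c → L i c = 0) :
    ∑ i ∈ Finset.range N, ∑ c ∈ Finset.range N,
        (M (i + 1) c - M (i + 1) (c + 1)) * (L (i + 1) (c + 1) - L (i + 2) (c + 1)) =
      ∑ i ∈ Finset.range N, ∑ c ∈ Finset.range N,
        (M i (c + 1) - M (i + 1) (c + 1)) * (L (i + 1) (c + 1) - L (i + 1) (c + 2)) := by
  rw [← sub_eq_zero]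
  simp only [← Finset.sum_sub_distrib]
  have hsplit : ∀ i c,
      (M (i + 1) c - M (i + 1) (c + 1)) * (L (i + 1) (c + 1) - L (i + 2) (c + 1)) -
        (M i (c + 1) - M (i + 1) (c + 1)) * (L (i + 1) (c + 1) - L (i + 1) (c + 2)) =
      (M (i + 1) (c + 1) * (L (i + 2) (c + 2) - L (i + 1) (c + 2)) -
        M (i + 1) c * (L (i + 2) (c + 1) - L (i + 1) (c + 1))) +
      (M (i + 1) (c + 1) * (L (i + 2) (c + 1) - L (i + 2) (c + 2)) -
        M i (c + 1) * (L (i + 1) (c + 1) - L (i + 1) (c + 2))) := fun i c => by ring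
  simp only [hsplit, Finset.sum_add_distrib]
  have hrow : ∀ i ∈ Finset.range N, ∑ c ∈ Finset.range N,
      (M (i + 1) (c + 1) * (L (i + 2) (c + 2) - L (i + 1) (c + 2)) -
        M (i + 1) c * (L (i + 2) (c + 1) - L (i + 1) (c + 1))) =
      L (i + 1) 1 - L (i + 2) 1 := fun i _ => by
    rw [Finset.sum_range_sub (fun c => M (i + 1) c * (L (i + 2) (c + 1) - L (i + 1) (c + 1))),
      hL (i + 2) (N + 1) (by omega), hL (i + 1) (N + 1) (by omega), hM₂]
    ring
  have hcol : ∀ c ∈ Finset.range N, ∑ i ∈ Finset.range N,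
      (M (i + 1) (c + 1) * (L (i + 2) (c + 1) - L (i + 2) (c + 2)) -
        M i (c + 1) * (L (i + 1) (c + 1) - L (i + 1) (c + 2))) =
      L 1 (c + 2) - L 1 (c + 1) := fun c _ => by
    rw [Finset.sum_range_sub (fun i => M i (c + 1) * (L (i + 1) (c + 1) - L (i + 1) (c + 2))),
      hL (N + 1) (c + 1) (by omega), hL (N + 1) (c + 2) (by omega), hM₁]
    ring
  rw [Finset.sum_congr rfl hrow, Finset.sum_comm, Finset.sum_congr rfl hcol,
    Finset.sum_range_sub' (fun i => L (i + 1) 1), Finset.sum_range_sub (fun c => L 1 (c + 1)),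
    hL (N + 1) 1 (by omega), hL 1 (N + 1) (by omega)]
  ring

/-- The rectangles of a fixed size inside a skew shape which can be moved neither left nor down
are as numerous as those which can be moved neither right nor up. -/
theorem card_blocked_rectangles {lam mu : ℕ → ℕ} (hlam : IsPartition lam)
    (hmu : IsPartition mu) {N : ℕ}
    (hN : ∀ i j, 1 ≤ i → 1 ≤ j → j ≤ lam i → i ≤ N ∧ j ≤ N) (a b : ℕ) :
    ((Finset.range N ×ˢ Finset.range N).filter fun q : ℕ × ℕ =>
        q.2 = mu (q.1 + 1) ∧ q.2 + 1 + a ≤ lam (q.1 + 1 + b) ∧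
          lam (q.1 + 2 + b) < q.2 + 1 + a).card =
      ((Finset.range N ×ˢ Finset.range N).filter fun q : ℕ × ℕ =>
        mu (q.1 + 1) < q.2 + 1 ∧ (q.1 = 0 ∨ q.2 + 1 ≤ mu q.1) ∧
          q.2 + 1 + a = lam (q.1 + 1 + b)).card := by
  have key := sum_mixed_differences (fun i c => if i = 0 ∨ c ≤ mu i then 1 else 0)
    (fun i c => if 1 ≤ i ∧ 1 ≤ c ∧ c + a ≤ lam (i + b) then 1 else 0) N (by simp) (by simp)
    (fun i c h => if_neg fun ⟨hi, hc, hic⟩ => by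
      have := hN (i + b) (c + a) (by omega) (by omega) hic
      omega)
  zify
  rw [Finset.card_filter, Finset.card_filter, Finset.sum_product, Finset.sum_product]
  push_cast
  convert key using 4 with i _ c _ i _ c _
  · have := hlam.1 (i + 1 + b) (i + 2 + b) (by omega) (by omega)
    simp only [Nat.add_one_ne_zero, false_or]
    split_ifs <;> omega
  · have : i = 0 ∨ mu (i + 1) ≤ mu i := by
      rcases Nat.eq_zero_or_pos i with h | h
      · exact Or.inl h
      · exact Or.inr (hmu.1 i (i + 1) h (by omega))
    simp only [Nat.add_one_ne_zero, false_or]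
    split_ifs <;> omega

/-- In a skew shape, the pairs (boxes to the left, boxes below) and (boxes to the right,
boxes above) are equidistributed. -/
theorem finsum_skew_left_down_eq_right_up {R : Type*} [AddCommMonoid R] {lam mu : ℕ → ℕ}
    (hlam : IsPartition lam) (hmu : IsPartition mu) (F : ℕ × ℕ → R) :
    ∑ᶠ x ∈ diagram lam \ diagram mu, F (x.2 - mu x.1 - 1, conj lam x.2 - x.1) =
      ∑ᶠ x ∈ diagram lam \ diagram mu, F (lam x.1 - x.2, x.1 - conj mu x.2 - 1) := by
  obtain ⟨N, hN⟩ := hlam.exists_bound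
  lift diagram lam \ diagram mu to Finset (ℕ × ℕ) using hlam.finite_diagram.sdiff with S hS
  have hmem : ∀ i j, (i, j) ∈ S ↔ 1 ≤ i ∧ 1 ≤ j ∧ j ≤ lam i ∧ mu i < j := fun i j => by
    rw [← Finset.mem_coe, hS]
    simp only [diagram, Set.mem_sdiff, Set.mem_ofPred_eq]
    omega
  rw [finsum_mem_coe_finset, finsum_mem_coe_finset]
  suffices h : S.val.map (fun x => (x.2 - mu x.1 - 1, conj lam x.2 - x.1)) =
      S.val.map (fun x => (lam x.1 - x.2, x.1 - conj mu x.2 - 1)) by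
    simpa using congrArg (fun m => (m.map F).sum) h
  ext ⟨a, b⟩
  rw [Multiset.count_map, Multiset.count_map]
  change (S.filter _).card = (S.filter _).card
  calc _ = _ := ?_
    _ = _ := card_blocked_rectangles hlam hmu hN a b
    _ = _ := ?_
  · refine Finset.card_nbij' (fun p => (p.1 - 1, p.2 - a - 1)) (fun q => (q.1 + 1, q.2 + 1 + a))
      ?_ ?_ ?_ ?_
    · rintro ⟨i, j⟩ h
      simp only [Finset.coe_filter, Set.mem_ofPred_eq, hmem, Prod.mk.injEq] at h
      obtain ⟨⟨hi, hj, hl, hm⟩, ha, hb⟩ := h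
      have h0 := (hlam.le_conj_iff hi hj).2 hl
      have h1 := hlam.le_conj_iff (i := i + b) (j := j) (by omega) hj
      have h2 := hlam.le_conj_iff (i := i + 1 + b) (j := j) (by omega) hj
      have h3 := hN i j hi hj hl
      obtain ⟨i, rfl⟩ := Nat.exists_eq_add_of_le' hi
      obtain ⟨c, rfl⟩ : ∃ c, j = c + 1 + a := ⟨j - a - 1, by omega⟩
      simp only [Finset.coe_filter, Set.mem_ofPred_eq, Finset.mem_product, Finset.mem_range,
        Nat.add_sub_cancel]
      rw [show i + 2 + b = i + 1 + 1 + b by omega]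
      omega
    · rintro ⟨i, c⟩ h
      simp only [Finset.coe_filter, Set.mem_ofPred_eq, Finset.mem_product, Finset.mem_range] at h
      obtain ⟨-, hm, hl, hl'⟩ := h
      have h1 := hlam.le_conj_iff (i := i + 1 + b) (j := c + 1 + a) (by omega) (by omega)
      have h2 := hlam.le_conj_iff (i := i + 2 + b) (j := c + 1 + a) (by omega) (by omega)
      have := hlam.1 (i + 1) (i + 1 + b) (by omega) (by omega)
      simp only [Finset.coe_filter, Set.mem_ofPred_eq, hmem, Prod.mk.injEq]
      omega
    · rintro ⟨i, j⟩ h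
      simp only [Finset.coe_filter, Set.mem_ofPred_eq, hmem, Prod.mk.injEq] at h
      simp only [Prod.mk.injEq]
      omega
    · rintro ⟨i, c⟩ -
      simp only [Prod.mk.injEq]
      omega
  · symm
    refine Finset.card_nbij' (fun p => (p.1 - b - 1, p.2 - 1)) (fun q => (q.1 + 1 + b, q.2 + 1))
      ?_ ?_ ?_ ?_
    · rintro ⟨i, j⟩ h
      simp only [Finset.coe_filter, Set.mem_ofPred_eq, hmem, Prod.mk.injEq] at h
      obtain ⟨⟨hi, hj, hl, hm⟩, ha, hb⟩ := h
      have h0 := hmu.le_conj_iff hi hj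
      obtain ⟨k, rfl⟩ : ∃ k, i = k + 1 + b := ⟨i - b - 1, by omega⟩
      have h1 := hmu.le_conj_iff (i := k + 1) (j := j) (by omega) hj
      have h2 : k = 0 ∨ (k ≤ conj mu j ↔ j ≤ mu k) := by
        rcases Nat.eq_zero_or_pos k with h | h
        · exact Or.inl h
        · exact Or.inr (hmu.le_conj_iff h hj)
      have h3 := hN _ j hi hj hl
      have e : k + 1 + b - b - 1 = k := by omega
      simp only [Finset.coe_filter, Set.mem_ofPred_eq, Finset.mem_product, Finset.mem_range, e]
      omega
    · rintro ⟨i, c⟩ h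
      simp only [Finset.coe_filter, Set.mem_ofPred_eq, Finset.mem_product, Finset.mem_range] at h
      obtain ⟨-, hm, hm', hl⟩ := h
      have h1 := hmu.le_conj_iff (i := i + 1) (j := c + 1) (by omega) (by omega)
      have h2 : i = 0 ∨ (i ≤ conj mu (c + 1) ↔ c + 1 ≤ mu i) := by
        rcases Nat.eq_zero_or_pos i with h | h
        · exact Or.inl h
        · exact Or.inr (hmu.le_conj_iff h (by omega))
      have := hmu.1 (i + 1) (i + 1 + b) (by omega) (by omega)
      simp only [Finset.coe_filter, Set.mem_ofPred_eq, hmem, Prod.mk.injEq]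
      omega
    · rintro ⟨i, j⟩ h
      simp only [Finset.coe_filter, Set.mem_ofPred_eq, hmem, Prod.mk.injEq] at h
      simp only [Prod.mk.injEq]
      omega
    · rintro ⟨i, c⟩ -
      simp only [Prod.mk.injEq]
      omega

/-- On `λ \ μ`, the two kinds of signed arm-leg exponents are equidistributed. -/
theorem finsum_skew_eq {R : Type*} [AddCommMonoid R] {lam mu : ℕ → ℕ}
    (hlam : IsPartition lam) (hmu : IsPartition mu) (G : ℤ → ℤ → R) :
    ∑ᶠ x ∈ diagram lam \ diagram mu,
        G ((x.2 : ℤ) - (mu x.1 : ℤ)) ((conj lam x.2 : ℤ) - (x.1 : ℤ) + 1) =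
      ∑ᶠ x ∈ diagram lam \ diagram mu,
        G ((lam x.1 : ℤ) - (x.2 : ℤ) + 1) ((x.1 : ℤ) - (conj mu x.2 : ℤ)) := by
  have h := finsum_skew_left_down_eq_right_up hlam hmu
    (fun q => G ((q.1 : ℤ) + 1) ((q.2 : ℤ) + 1))
  convert h using 1
  all_goals
    refine finsum_mem_congr rfl ?_
    rintro ⟨i, j⟩ ⟨⟨hi, hj, hl⟩, hm⟩
    have hm' : ¬ j ≤ mu i := fun h => hm ⟨hi, hj, h⟩
    have h1 := (hlam.le_conj_iff hi hj).2 hl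
    have h2 := (hmu.le_conj_iff hi hj).not.2 hm'
    dsimp only at *
    congr 1 <;> omega

/-- The hook-type sum
`Σ_{□∈μ} z₁^{-a_μ(□)} z₂^{l_λ(□)+1} + Σ_{□∈λ} z₁^{a_λ(□)+1} z₂^{-l_μ(□)}`
is unchanged when the two ranges of summation `□ ∈ μ` and `□ ∈ λ` are interchanged. -/
theorem hook_sum_interchange {R : Type*} [CommRing R] (lam mu : ℕ → ℕ)
    (hlam : IsPartition lam) (hmu : IsPartition mu) (z₁ z₂ : Rˣ) :
    (∑ᶠ x ∈ diagram mu,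
        ((z₁ ^ ((x.2 : ℤ) - (mu x.1 : ℤ)) : Rˣ) : R) *
          ((z₂ ^ ((conj lam x.2 : ℤ) - (x.1 : ℤ) + 1) : Rˣ) : R))
      + (∑ᶠ x ∈ diagram lam,
          ((z₁ ^ ((lam x.1 : ℤ) - (x.2 : ℤ) + 1) : Rˣ) : R) *
            ((z₂ ^ ((x.1 : ℤ) - (conj mu x.2 : ℤ)) : Rˣ) : R))
      = (∑ᶠ x ∈ diagram lam,
          ((z₁ ^ ((x.2 : ℤ) - (mu x.1 : ℤ)) : Rˣ) : R) *
            ((z₂ ^ ((conj lam x.2 : ℤ) - (x.1 : ℤ) + 1) : Rˣ) : R))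
        + ∑ᶠ x ∈ diagram mu,
          ((z₁ ^ ((lam x.1 : ℤ) - (x.2 : ℤ) + 1) : Rˣ) : R) *
            ((z₂ ^ ((x.1 : ℤ) - (conj mu x.2 : ℤ)) : Rˣ) : R) := by
  have hpos := finsum_skew_eq hlam hmu
    (fun s t => ((z₁ ^ s : Rˣ) : R) * ((z₂ ^ t : Rˣ) : R))
  have hneg := finsum_skew_eq hmu hlam
    (fun s t => ((z₁ ^ (1 - s) : Rˣ) : R) * ((z₂ ^ (1 - t) : Rˣ) : R))
  have e₁ : ∀ s t : ℤ, 1 - (s - t) = t - s + 1 := fun s t => by ring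
  have e₂ : ∀ s t : ℤ, 1 - (s - t + 1) = t - s := fun s t => by ring
  simp only [e₁, e₂] at hneg
  have hinter := Set.inter_comm (diagram mu) (diagram lam)
  rw [← finsum_mem_inter_add_sdiff (s := diagram mu) (diagram lam) hmu.finite_diagram,
    ← finsum_mem_inter_add_sdiff (s := diagram lam) (diagram mu) hlam.finite_diagram,
    ← finsum_mem_inter_add_sdiff (s := diagram lam) (diagram mu) hlam.finite_diagram,
    ← finsum_mem_inter_add_sdiff (s := diagram mu) (diagram lam) hmu.finite_diagram,
    hinter, hpos, hneg]
  ring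
end

section
/- Let λ and μ be partitions and let z₁, z₂ be invertible elements of a commutative ring R. Define E_{λ,μ}(z₁,z₂) = Σ_{(i,j)∈μ} z₁^{j−μ_i} z₂^{λ'_j−i+1} + Σ_{(i,j)∈λ} z₁^{λ_i−j+1} z₂^{i−μ'_j}. Then the Serre-duality symmetry holds: E_{λ,μ}(z₁, z₂) = z₁ z₂ · E_{μ,λ}(z₁⁻¹, z₂⁻¹). -/
/-! Carlsson–Okounkov, "Exts and Vertex Operators": the Serre-duality symmetry `E_{λ,μ}(z₁,z₂) = z₁ z₂ E_{μ,λ}(z₁⁻¹,z₂⁻¹)` of the fixed-point character of `𝖤`. -/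

open scoped BigOperators

/-- The hook-type character sum
`E_{λ,μ}(z₁,z₂) = Σ_{□∈μ} z₁^{-a_μ(□)} z₂^{l_λ(□)+1} + Σ_{□∈λ} z₁^{a_λ(□)+1} z₂^{-l_μ(□)}`,
i.e. `Σ_{(i,j)∈μ} z₁^{j−μ_i} z₂^{λ'_j−i+1} + Σ_{(i,j)∈λ} z₁^{λ_i−j+1} z₂^{i−μ'_j}`. -/
noncomputable def hookSum {R : Type*} [CommRing R] (lam mu : ℕ → ℕ) (z₁ z₂ : Rˣ) : R :=
  (∑ᶠ x ∈ diagram mu,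
      ((z₁ ^ ((x.2 : ℤ) - (mu x.1 : ℤ)) : Rˣ) : R) *
        ((z₂ ^ ((conj lam x.2 : ℤ) - (x.1 : ℤ) + 1) : Rˣ) : R))
    + ∑ᶠ x ∈ diagram lam,
        ((z₁ ^ ((lam x.1 : ℤ) - (x.2 : ℤ) + 1) : Rˣ) : R) *
          ((z₂ ^ ((x.1 : ℤ) - (conj mu x.2 : ℤ)) : Rˣ) : R)

/-- Inverting both variables in a Laurent monomial and multiplying by their product. -/
theorem mul_mul_inv_zpow_mul_inv_zpow {R : Type*} [CommRing R] (z₁ z₂ : Rˣ) (a b : ℤ) :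
    (z₁ : R) * (z₂ : R) * (((z₁⁻¹ ^ a : Rˣ) : R) * ((z₂⁻¹ ^ b : Rˣ) : R)) =
      ((z₁ ^ (1 - a) : Rˣ) : R) * ((z₂ ^ (1 - b) : Rˣ) : R) := by
  norm_cast
  rw [mul_mul_mul_comm, inv_zpow', inv_zpow', ← zpow_one_add, ← zpow_one_add, sub_eq_add_neg,
    sub_eq_add_neg]

/-- Serre duality: `E_{λ,μ}(z₁, z₂) = z₁ z₂ · E_{μ,λ}(z₁⁻¹, z₂⁻¹)`. -/
theorem hookSum_serre_duality {R : Type*} [CommRing R] (lam mu : ℕ → ℕ)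
    (hlam : IsPartition lam) (hmu : IsPartition mu) (z₁ z₂ : Rˣ) :
    hookSum lam mu z₁ z₂ = (z₁ : R) * (z₂ : R) * hookSum mu lam z₁⁻¹ z₂⁻¹ := by
  unfold hookSum
  rw [mul_add, mul_finsum_mem' _ _ hlam.finite_diagram, mul_finsum_mem' _ _ hmu.finite_diagram,
    add_comm]
  simp only [mul_mul_inv_zpow_mul_inv_zpow]
  congr 1 <;> refine finsum_mem_congr rfl fun x _ => ?_ <;> congr 3 <;> ring
end
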